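/- arXiv:2009.13947 — 2 statements merged into one kernel-verified Lean document; each statement's English description precedes it below -/
import Mathlib

section
/- With the data (I, (F_i^#), (F_i), (τ_i), (a_i), (c_i), W, q_W, X_W) as in the context, let U = {u = (u_i)_{i∈I} ∈ ∏_i F_i^× : u_i·τ_i(u_i) = 1 for all i}, a group under componentwise multiplication. The map sending u ∈ U to the F-linear endomorphism of W acting on each summand F_i by multiplication by u_i is a group isomorphism from U onto the group {g ∈ GL_F(W) : q_W(g v, g w) = q_W(v, w) for all v, w ∈ W, and g ∘ X_W = X_W ∘ g}, i.e. onto the centralizer of X_W in the orthogonal group of (W, q_W). -/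
open scoped TensorProduct

/-- One factor `F_i` of the data in the context: a finite field extension `Fs = F_i^#` of
`F`, an étale quadratic `Fs`-algebra `A = F_i` (reduced and free of rank 2 over `Fs`,
hence either a quadratic field extension of `Fs` or `Fs × Fs`), the nontrivial
`Fs`-algebra involution `τ` with fixed subalgebra `Fs`, and units `a, c ∈ A` with
`τ a = −a`, `τ c = c` and `a` generating `A` as an `F`-algebra. -/
structure QuadDatum (F : Type*) [Field F] where
  Fs : Type*
  [fieldFs : Field Fs]
  [algFFs : Algebra F Fs]
  [finFFs : FiniteDimensional F Fs]
  A : Type*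
  [ringA : CommRing A]
  [algFA : Algebra F A]
  [algFsA : Algebra Fs A]
  [towerA : IsScalarTower F Fs A]
  [redA : IsReduced A]
  [finFA : Module.Finite F A]
  [freeFsA : Module.Free Fs A]
  rank_two : Module.finrank Fs A = 2
  τ : A ≃ₐ[Fs] A
  τ_ne : τ ≠ AlgEquiv.refl
  τ_invol : ∀ x : A, τ (τ x) = x
  τ_fixed : ∀ x : A, τ x = x ↔ x ∈ (algebraMap Fs A).range
  a : A
  a_unit : IsUnit a
  τ_a : τ a = -a
  a_gen : Algebra.adjoin F {a} = ⊤
  c : A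
  c_unit : IsUnit c
  τ_c : τ c = c

attribute [instance] QuadDatum.fieldFs QuadDatum.algFFs QuadDatum.finFFs QuadDatum.ringA
  QuadDatum.algFA QuadDatum.algFsA QuadDatum.towerA QuadDatum.redA QuadDatum.finFA
  QuadDatum.freeFsA

open Polynomial

/-- The trace form of a reduced finite-dimensional commutative algebra over a field of
characteristic zero is nondegenerate. -/
theorem eq_zero_of_forall_trace_mul_eq_zero {F A : Type*} [Field F] [CharZero F] [CommRing A]
    [IsReduced A] [Algebra F A] [Module.Finite F A] {x : A}
    (h : ∀ y, Algebra.trace F A (x * y) = 0) : x = 0 := by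
  have : IsArtinianRing A := IsArtinianRing.of_finite F A
  obtain ⟨n, y, hy⟩ := IsArtinian.exists_pow_succ_smul_dvd x (1 : A)
  simp only [smul_eq_mul, mul_one, Nat.succ_eq_add_one] at hy
  have hx : x * (1 - x * y) = 0 := by
    refine eq_zero_of_pow_eq_zero (n := n + 1) ?_
    rw [mul_pow, pow_succ (1 - x * y)]
    linear_combination -(x * (1 - x * y) ^ n) * hy
  have hid : IsIdempotentElem (Algebra.lmul F A (x * y)) := by
    refine IsIdempotentElem.map ?_ (Algebra.lmul F A)
    rw [IsIdempotentElem]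
    linear_combination -y * hx
  have hzero := (LinearMap.IsIdempotentElem.trace_eq_zero_iff hid).1 (h y)
  have hxy : x * y = 0 := by simpa using LinearMap.congr_fun hzero 1
  linear_combination hx + x * hxy

theorem isUnit_of_dvd_minpoly_of_isUnit_aeval {F A : Type*} [Field F] [CommRing A] [Algebra F A]
    {a : A} (ha : IsIntegral F a) {d : F[X]} (hd : d ∣ minpoly F a)
    (hu : IsUnit (aeval a d)) : IsUnit d := by
  obtain ⟨q, hq⟩ := hd
  have hqa : aeval a q = 0 := by
    have := minpoly.aeval F a
    rw [hq, map_mul] at this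
    exact (hu.mul_right_eq_zero).1 this
  obtain ⟨r, hr⟩ := minpoly.dvd F a hqa
  refine IsUnit.of_mul_eq_one r (mul_left_cancel₀ (minpoly.ne_zero ha) ?_)
  linear_combination -hq - d * hr

theorem LinearMap.map_aeval_mul {F A B : Type*} [CommRing F] [CommRing A] [CommRing B]
    [Algebra F A] [Algebra F B] (h : A →ₗ[F] B) {a : A} {b : B}
    (hab : ∀ x, h (a * x) = b * h x) (p : F[X]) (x : A) :
    h (aeval a p * x) = aeval b p * h x := by
  induction p using Polynomial.induction_on' generalizing x with
  | add p q hp hq => simp only [map_add, add_mul, hp, hq]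
  | monomial n c =>
    have hpow : ∀ n x, h (a ^ n * x) = b ^ n * h x := by
      intro n
      induction n with
      | zero => simp
      | succ n ih => intro x; rw [pow_succ, mul_assoc, ih, hab, pow_succ, mul_assoc]
    simp only [aeval_monomial, ← Algebra.smul_def, smul_mul_assoc, map_smul, hpow]

theorem aeval_surjective_of_adjoin_eq_top {F A : Type*} [CommRing F] [CommRing A] [Algebra F A]
    {a : A} (ha : Algebra.adjoin F {a} = ⊤) :
    Function.Surjective (aeval a : F[X] →ₐ[F] A) := by
  rw [← AlgHom.range_eq_top, ← Algebra.adjoin_singleton_eq_range_aeval, ha]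

theorem exists_algEquiv_of_minpoly_eq {F A B : Type*} [Field F] [CommRing A] [CommRing B]
    [Algebra F A] [Algebra F B] {a : A} {b : B} (ha : Algebra.adjoin F {a} = ⊤)
    (hb : Algebra.adjoin F {b} = ⊤) (h : minpoly F a = minpoly F b) :
    ∃ e : A ≃ₐ[F] B, e a = b := by
  have hk : RingHom.ker (aeval a : F[X] →ₐ[F] A) = RingHom.ker (aeval b : F[X] →ₐ[F] B) := by
    rw [minpoly.ker_aeval_eq_span_minpoly, minpoly.ker_aeval_eq_span_minpoly, h]
  have hsa := aeval_surjective_of_adjoin_eq_top ha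
  have hsb := aeval_surjective_of_adjoin_eq_top hb
  refine ⟨(Ideal.quotientKerAlgEquivOfSurjective hsa).symm.trans
    ((Ideal.quotientEquivAlgOfEq F hk).trans (Ideal.quotientKerAlgEquivOfSurjective hsb)), ?_⟩
  have hX := Ideal.quotientKerAlgEquivOfSurjective_symm_apply hsa X
  rw [aeval_X] at hX
  simp [hX]

namespace QuadDatum

variable {F : Type*} [Field F]

instance nontrivial_A (D : QuadDatum F) : Nontrivial D.A :=
  Module.nontrivial_of_finrank_pos (R := D.Fs) (by rw [D.rank_two]; norm_num)

theorem mul_τ_eq_zero (D : QuadDatum F) {x : D.A} (hx : ¬ IsUnit x) : x * D.τ x = 0 := by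
  obtain ⟨s, hs⟩ := (D.τ_fixed (x * D.τ x)).1 (by rw [map_mul, D.τ_invol, mul_comm])
  rw [← hs]
  by_contra hne
  refine hx (isUnit_of_mul_isUnit_left (y := D.τ x) ?_)
  rw [← hs]
  exact (IsUnit.mk0 s fun h ↦ hne (by rw [h, map_zero])).map (algebraMap D.Fs D.A)

theorem τ_aeval_a (D : QuadDatum F) (p : F[X]) :
    D.τ (aeval D.a p) = aeval D.a (p.comp (-X)) := by
  have h := aeval_algHom_apply ((D.τ : D.A →ₐ[D.Fs] D.A).restrictScalars F) D.a p
  change aeval (D.τ D.a) p = D.τ (aeval D.a p) at h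
  rw [← h, D.τ_a, aeval_comp, map_neg, aeval_X]

theorem isIntegral_a (D : QuadDatum F) : IsIntegral F D.a := Algebra.IsIntegral.isIntegral _

theorem minpoly_a_dvd_comp_neg_X (D : QuadDatum F) :
    minpoly F D.a ∣ (minpoly F D.a).comp (-X) := by
  apply minpoly.dvd
  rw [← D.τ_aeval_a, minpoly.aeval, map_zero]

theorem minpoly_a_dvd (D : QuadDatum F) {d : F[X]} (hd : d ∣ minpoly F D.a)
    (hu : ¬ IsUnit d) (hs : d.comp (-X) ∣ d) : minpoly F D.a ∣ d := by
  obtain ⟨q, hq⟩ := hs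
  have hmul := D.mul_τ_eq_zero
    (mt (isUnit_of_dvd_minpoly_of_isUnit_aeval D.isIntegral_a hd) hu)
  have hda := congrArg (aeval D.a) hq
  rw [map_mul, ← D.τ_aeval_a] at hda
  refine minpoly.dvd F D.a (eq_zero_of_pow_eq_zero (n := 2) ?_)
  linear_combination aeval D.a d * hda + aeval D.a q * hmul

theorem isCoprime_minpoly_a {D E : QuadDatum F} (h : ∀ e : D.A ≃ₐ[F] E.A, e D.a ≠ E.a) :
    IsCoprime (minpoly F D.a) (minpoly F E.a) := by
  classical
  by_contra hc
  have hu : ¬ IsUnit (EuclideanDomain.gcd (minpoly F D.a) (minpoly F E.a)) := by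
    rwa [EuclideanDomain.gcd_isUnit_iff]
  have hD := EuclideanDomain.gcd_dvd_left (minpoly F D.a) (minpoly F E.a)
  have hE := EuclideanDomain.gcd_dvd_right (minpoly F D.a) (minpoly F E.a)
  have hs := EuclideanDomain.dvd_gcd
    ((dvd_comp_neg_X_iff _ _).1 (hD.trans D.minpoly_a_dvd_comp_neg_X))
    ((dvd_comp_neg_X_iff _ _).1 (hE.trans E.minpoly_a_dvd_comp_neg_X))
  have heq : minpoly F D.a = minpoly F E.a :=
    eq_of_monic_of_associated (minpoly.monic D.isIntegral_a) (minpoly.monic E.isIntegral_a)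
      (associated_of_dvd_dvd ((D.minpoly_a_dvd hD hu hs).trans hE)
        ((E.minpoly_a_dvd hE hu hs).trans hD))
  obtain ⟨e, he⟩ := exists_algEquiv_of_minpoly_eq D.a_gen E.a_gen heq
  exact h e he

theorem linearMap_eq_zero {D E : QuadDatum F} (h : ∀ e : D.A ≃ₐ[F] E.A, e D.a ≠ E.a)
    (f : D.A →ₗ[F] E.A) (hf : ∀ x, f (D.a * x) = E.a * f x) (x : D.A) : f x = 0 := by
  obtain ⟨p, q, hpq⟩ := isCoprime_minpoly_a h
  have hm : aeval E.a (minpoly F D.a) * f x = 0 := by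
    rw [← f.map_aeval_mul hf, minpoly.aeval, zero_mul, map_zero]
  have hone := congrArg (aeval E.a) hpq
  simp only [map_add, map_mul, minpoly.aeval, mul_zero, add_zero, map_one] at hone
  linear_combination aeval E.a p * hm - f x * hone

theorem linearMap_eq_mul (D : QuadDatum F) (f : D.A →ₗ[F] D.A)
    (hf : ∀ x, f (D.a * x) = D.a * f x) (x : D.A) : f x = f 1 * x := by
  obtain ⟨p, rfl⟩ := aeval_surjective_of_adjoin_eq_top D.a_gen x
  rw [← mul_one (aeval D.a p), f.map_aeval_mul hf, mul_one, mul_comm]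

/-- An endomorphism of `⊕_i F_i` commuting with multiplication by `(a_i)_i` is
multiplication by its value at `1`. -/
theorem end_apply_eq_mul {I : Type*} [Fintype I] [DecidableEq I] {D : I → QuadDatum F}
    (hdist : ∀ i j : I, i ≠ j → ∀ e : (D i).A ≃ₐ[F] (D j).A, e (D i).a ≠ (D j).a)
    (g : Module.End F (∀ i, (D i).A))
    (hg : ∀ v, g (fun i ↦ (D i).a * v i) = fun i ↦ (D i).a * g v i)
    (v : ∀ i, (D i).A) (j : I) : g v j = g 1 j * v j := by
  let f (i : I) : (D i).A →ₗ[F] (D j).A :=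
    LinearMap.proj j ∘ₗ g ∘ₗ LinearMap.single F (fun i ↦ (D i).A) i
  have hf (i : I) (x : (D i).A) : f i ((D i).a * x) = (D j).a * f i x := by
    have hsingle : Pi.single i ((D i).a * x) =
        fun k ↦ (D k).a * (Pi.single i x : ∀ k, (D k).A) k := by
      ext k
      by_cases hk : k = i
      · subst hk; simp
      · simp [hk]
    simp only [f, LinearMap.comp_apply, LinearMap.proj_apply, LinearMap.single_apply, hsingle, hg]
  have hsum (w : ∀ i, (D i).A) : g w j = f j (w j) := by
    conv_lhs => rw [← Finset.univ_sum_single w]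
    rw [map_sum, Finset.sum_apply, Finset.sum_eq_single j]
    · rfl
    · exact fun i _ hij ↦ linearMap_eq_zero (hdist i j hij) (f i) (hf i) (w i)
    · simp
  rw [hsum, hsum, (D j).linearMap_eq_mul (f j) (hf j)]
  rfl

end QuadDatum

/-- With `W = ⊕_i F_i`, `q_W` as in the context, `X_W` acting by `a_i`,
and `U = {u ∈ ∏ F_i^× : u_i·τ_i(u_i) = 1}`, the map sending `u` to the endomorphism of
`W` acting by multiplication by `u_i` on each summand is multiplicative and restricts to
a bijection from `U` onto the centralizer of `X_W` in the orthogonal group of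
`(W, q_W)`, i.e. onto
`{g : invertible endomorphisms preserving q_W and commuting with X_W}`;
in other words, it is a group isomorphism from `U` onto that group. -/
theorem stmt_9 (F : Type*) [Field F] [CharZero F]
    (I : Type*) [Fintype I] [DecidableEq I] (D : I → QuadDatum F)
    (hdist : ∀ i j : I, i ≠ j → ∀ e : (D i).A ≃ₐ[F] (D j).A, e (D i).a ≠ (D j).a)
    (qW : (∀ i, (D i).A) → (∀ i, (D i).A) → F)
    (hqW : ∀ v w : ∀ i, (D i).A, qW v w =
      ∑ i, (Module.finrank F (D i).A : F)⁻¹ *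
        Algebra.trace F (D i).A ((D i).τ (v i) * w i * (D i).c))
    (XW : Module.End F (∀ i, (D i).A))
    (hXW : ∀ (v : ∀ i, (D i).A) (i : I), XW v i = (D i).a * v i)
    (Φ : (∀ i, (D i).A) → Module.End F (∀ i, (D i).A))
    (hΦ : ∀ (u v : ∀ i, (D i).A) (i : I), Φ u v i = u i * v i) :
    (∀ u u' : ∀ i, (D i).A, Φ (u * u') = Φ u * Φ u') ∧
    Set.BijOn Φ
      {u : ∀ i, (D i).A | (∀ i, IsUnit (u i)) ∧ ∀ i, u i * (D i).τ (u i) = 1}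
      {g : Module.End F (∀ i, (D i).A) | Function.Bijective g ∧
        (∀ v w : ∀ i, (D i).A, qW (g v) (g w) = qW v w) ∧ g * XW = XW * g} := by
  have hdiag (g : Module.End F (∀ i, (D i).A)) (u : ∀ i, (D i).A)
      (h : ∀ v i, g v i = u i * v i) : Φ u = g := by
    refine LinearMap.ext fun v ↦ funext fun i ↦ ?_
    rw [hΦ, h]
  have hmul (u u' : ∀ i, (D i).A) : Φ (u * u') = Φ u * Φ u' :=
    hdiag _ _ fun v i ↦ by rw [Module.End.mul_apply, hΦ, hΦ, Pi.mul_apply, mul_assoc]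
  have hone : Φ 1 = 1 := hdiag _ _ fun v i ↦ by simp
  refine ⟨hmul, ?_, ?_, ?_⟩
  · rintro u ⟨-, hu⟩
    have hinv : u * (fun i ↦ (D i).τ (u i)) = 1 := funext hu
    have hunit : IsUnit (Φ u) := by
      refine isUnit_iff_exists.2 ⟨Φ fun i ↦ (D i).τ (u i), ?_, ?_⟩
      · rw [← hmul, hinv, hone]
      · rw [← hmul, mul_comm, hinv, hone]
    refine ⟨(Module.End.isUnit_iff _).1 hunit, fun v w ↦ ?_, ?_⟩
    · rw [hqW, hqW]
      refine Finset.sum_congr rfl fun i _ ↦ ?_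
      congr 2
      rw [hΦ, hΦ, map_mul]
      linear_combination ((D i).τ (v i) * w i * (D i).c) * hu i
    · refine LinearMap.ext fun v ↦ funext fun i ↦ ?_
      rw [Module.End.mul_apply, Module.End.mul_apply, hΦ, hXW, hXW, hΦ, mul_left_comm]
  · intro u _ u' _ h
    funext i
    have := congrFun (LinearMap.congr_fun h 1) i
    simpa [hΦ] using this
  · rintro g ⟨-, hq, hcomm⟩
    have hX (v : ∀ i, (D i).A) : XW v = fun i ↦ (D i).a * v i := funext (hXW v)
    obtain ⟨u, hg⟩ : ∃ u : ∀ i, (D i).A, ∀ v i, g v i = u i * v i :=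
      ⟨g 1, QuadDatum.end_apply_eq_mul hdist g fun v ↦ by
        rw [← hX, ← hX]
        exact LinearMap.congr_fun hcomm v⟩
    have hu (i : I) : u i * (D i).τ (u i) = 1 := by
      have htr (z : (D i).A) :
          Algebra.trace F (D i).A ((u i * (D i).τ (u i) - 1) * (D i).c * z) = 0 := by
        have hz (j : I) (hj : j ≠ i) : (Pi.single i z : ∀ i, (D i).A) j = 0 :=
          Pi.single_eq_of_ne (M := fun i ↦ (D i).A) hj z
        have h := hq (Pi.single i 1) (Pi.single i z)
        rw [hqW, hqW, Finset.sum_eq_single i, Finset.sum_eq_single i] at h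
        · have hn : (Module.finrank F (D i).A : F)⁻¹ ≠ 0 :=
            inv_ne_zero (Nat.cast_ne_zero.2 Module.finrank_pos.ne')
          have h := mul_left_cancel₀ hn h
          rw [hg (Pi.single i 1), hg (Pi.single i z), Pi.single_eq_same, Pi.single_eq_same,
            mul_one, map_one, one_mul, ← sub_eq_zero, ← map_sub] at h
          rw [← h]
          congr 1
          ring
        · intro j _ hj
          rw [hz j hj, mul_zero, zero_mul, map_zero, mul_zero]
        · exact fun hi ↦ absurd (Finset.mem_univ i) hi
        · intro j _ hj
          rw [hg (Pi.single i z), hz j hj, mul_zero, mul_zero, zero_mul, map_zero, mul_zero]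
        · exact fun hi ↦ absurd (Finset.mem_univ i) hi
      have h0 := eq_zero_of_forall_trace_mul_eq_zero htr
      exact sub_eq_zero.1 (((D i).c_unit.mul_left_eq_zero).1 h0)
    exact ⟨u, ⟨fun i ↦ IsUnit.of_mul_eq_one _ (hu i), hu⟩, hdiag g _ hg⟩
end

section
/- Let F be a field of characteristic zero, V an F-vector space of dimension 2n+1, and B a nondegenerate symmetric bilinear form on V admitting a totally isotropic subspace of dimension n (i.e. B is split). Write so(V, B) for the space of endomorphisms X with B(Xv, w) + B(v, Xw) = 0 for all v, w. If N and N' are nilpotent elements of so(V, B) whose centralizers {Y ∈ so(V, B) : commuting with N} and {Y ∈ so(V, B) : commuting with N'} each have dimension n, then there exists g ∈ GL_F(V) with B(g v, g w) = B(v, w) for all v, w, det g = 1, and g∘N∘g^{-1} = N'. In other words, SO(V, B)(F) acts transitively on the regular nilpotent elements of so(V, B). -/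
/-- The centralizer of an endomorphism `N` inside the Lie algebra `so(V, B)` of
`B`-skew-adjoint endomorphisms, as a submodule of `End F V`. -/
def soCent (F V : Type*) [Field F] [AddCommGroup V] [Module F V]
    (B : V →ₗ[F] V →ₗ[F] F) (N : Module.End F V) : Submodule F (Module.End F V) where
  carrier := {Y | (∀ v w, B (Y v) w + B v (Y w) = 0) ∧ N * Y = Y * N}
  add_mem' := by
    rintro a b ⟨ha1, ha2⟩ ⟨hb1, hb2⟩
    refine ⟨fun v w => ?_, by rw [mul_add, add_mul, ha2, hb2]⟩
    have h1 := ha1 v w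
    have h2 := hb1 v w
    simp only [LinearMap.add_apply, map_add] at *
    linear_combination h1 + h2
  zero_mem' := by
    refine ⟨fun v w => ?_, by rw [mul_zero, zero_mul]⟩
    simp
  smul_mem' := by
    rintro t a ⟨ha1, ha2⟩
    refine ⟨fun v w => ?_, by rw [mul_smul_comm, smul_mul_assoc, ha2]⟩
    have h1 := ha1 v w
    simp only [LinearMap.smul_apply, map_smul, smul_eq_mul]
    linear_combination t * h1

section RegularNilpotent

variable {F V : Type*} [Field F] [AddCommGroup V] [Module F V]

theorem skew_pow_apply {B : V →ₗ[F] V →ₗ[F] F} {N : Module.End F V}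
    (hN : ∀ v w : V, B (N v) w + B v (N w) = 0) (i : ℕ) (v w : V) :
    B ((N ^ i) v) w = (-1) ^ i * B v ((N ^ i) w) := by
  induction i generalizing v w with
  | zero => simp
  | succ i ih =>
    rw [pow_succ N, Module.End.mul_apply, ih, ← pow_succ N, pow_succ (-1 : F), pow_succ' N,
      Module.End.mul_apply]
    linear_combination (-1) ^ i * hN v ((N ^ i) w)

/-- The sum of the operators `N ^ i * A * N ^ (m - 1 - i)`, which commutes with `N` when
`N ^ m = 0`. -/
def conjSum (N : Module.End F V) (m : ℕ) (A : Module.End F V) : Module.End F V :=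
  ∑ i ∈ Finset.range m, N ^ i * A * N ^ (m - 1 - i)

theorem mul_conjSum {N : Module.End F V} {m : ℕ} (hm : N ^ m = 0) (A : Module.End F V) :
    N * conjSum N m A = conjSum N m A * N := by
  have h := Finset.sum_range_sub (fun i => N ^ i * A * N ^ (m - i)) m
  simp only [hm, Nat.sub_zero, zero_mul, mul_zero, sub_zero, Finset.sum_sub_distrib] at h
  rw [← sub_eq_zero, ← h, conjSum, Finset.mul_sum, Finset.sum_mul]
  congr 1
  · refine Finset.sum_congr rfl fun i _ => ?_
    rw [pow_succ', Nat.sub_sub, add_comm 1 i]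
    noncomm_ring
  · refine Finset.sum_congr rfl fun i hi => ?_
    rw [mul_assoc _ _ N, ← pow_succ]
    congr 2
    have := Finset.mem_range.1 hi
    omega

theorem conjSum_skew {B : V →ₗ[F] V →ₗ[F] F} {N : Module.End F V}
    (hN : ∀ v w : V, B (N v) w + B v (N w) = 0) (m : ℕ) {A : Module.End F V}
    (hA : ∀ v w : V, B (A v) w = (-1) ^ m * B v (A w)) (v w : V) :
    B (conjSum N m A v) w + B v (conjSum N m A w) = 0 := by
  have h : ∑ i ∈ Finset.range m, B v ((N ^ i * A * N ^ (m - 1 - i)) w) =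
      ∑ i ∈ Finset.range m, B v ((N ^ (m - 1 - i) * A * N ^ i) w) := by
    rw [← Finset.sum_range_reflect]
    refine Finset.sum_congr rfl fun i hi => ?_
    have := Finset.mem_range.1 hi
    rw [show m - 1 - (m - 1 - i) = i by omega]
  simp only [conjSum, LinearMap.sum_apply, map_sum]
  rw [h, ← Finset.sum_add_distrib]
  refine Finset.sum_eq_zero fun i hi => ?_
  have hi := Finset.mem_range.1 hi
  simp only [Module.End.mul_apply]
  rw [skew_pow_apply hN, hA, skew_pow_apply hN]
  obtain ⟨k, rfl⟩ : ∃ k, m = i + k + 1 := ⟨m - 1 - i, by omega⟩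
  rw [show i + k + 1 - 1 - i = k by omega]
  have h1 : ((-1 : F) ^ i * (-1) ^ i) = 1 := by rw [← mul_pow]; simp
  have h2 : ((-1 : F) ^ k * (-1) ^ k) = 1 := by rw [← mul_pow]; simp
  rw [pow_succ, pow_add]
  linear_combination (-((-1) ^ k * (-1) ^ k) * h1 - h2) *
    B v ((N ^ k) (A ((N ^ i) w)))

/-- The rank-two operator attached to `u` and `v`, self-adjoint up to the sign `(-1) ^ m`. -/
def rankTwo (B : V →ₗ[F] V →ₗ[F] F) (m : ℕ) (u v : V) : Module.End F V :=
  (B v).smulRight u + (-1 : F) ^ m • (B u).smulRight v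

theorem rankTwo_adjoint {B : V →ₗ[F] V →ₗ[F] F} (hsymm : ∀ v w : V, B v w = B w v)
    (m : ℕ) (u v x y : V) :
    B (rankTwo B m u v x) y = (-1) ^ m * B x (rankTwo B m u v y) := by
  have h : ((-1 : F) ^ m * (-1) ^ m) = 1 := by rw [← mul_pow]; simp
  simp only [rankTwo, LinearMap.add_apply, LinearMap.smul_apply, LinearMap.smulRight_apply,
    map_add, map_smul, smul_eq_mul, hsymm x]
  linear_combination - B v x * B u y * h

theorem conjSum_rankTwo_mem {B : V →ₗ[F] V →ₗ[F] F} (hsymm : ∀ v w : V, B v w = B w v)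
    {N : Module.End F V} (hN : ∀ v w : V, B (N v) w + B v (N w) = 0) {m : ℕ} (hm : N ^ m = 0)
    (u v : V) : conjSum N m (rankTwo B m u v) ∈ soCent F V B N :=
  ⟨conjSum_skew hN m (rankTwo_adjoint hsymm m u v), mul_conjSum hm _⟩

open Polynomial in
/-- The generating polynomial of the pairings of `v` with the iterates of `N` on `w`. -/
noncomputable def pairingPoly (B : V →ₗ[F] V →ₗ[F] F) (N : Module.End F V) (m : ℕ) (v w : V) :
    F[X] :=
  ∑ i ∈ Finset.range m, C (B v ((N ^ (m - 1 - i)) w)) * X ^ i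

theorem aeval_pairingPoly (B : V →ₗ[F] V →ₗ[F] F) (N : Module.End F V) (m : ℕ) (v w u : V) :
    Polynomial.aeval N (pairingPoly B N m v w) u =
      ∑ i ∈ Finset.range m, B v ((N ^ (m - 1 - i)) w) • (N ^ i) u := by
  simp [pairingPoly, LinearMap.sum_apply, Module.algebraMap_end_apply]

theorem conjSum_smulRight_apply (B : V →ₗ[F] V →ₗ[F] F) (N : Module.End F V) (m : ℕ)
    (v w u : V) : conjSum N m ((B v).smulRight u) w =
      Polynomial.aeval N (pairingPoly B N m v w) u := by
  simp [aeval_pairingPoly, conjSum, LinearMap.sum_apply]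

theorem conjSum_rankTwo_apply (B : V →ₗ[F] V →ₗ[F] F) (N : Module.End F V) (m : ℕ) (u v w : V) :
    conjSum N m (rankTwo B m u v) w = Polynomial.aeval N (pairingPoly B N m v w) u +
      (-1 : F) ^ m • Polynomial.aeval N (pairingPoly B N m u w) v := by
  rw [← conjSum_smulRight_apply, ← conjSum_smulRight_apply]
  simp [conjSum, rankTwo, LinearMap.sum_apply, Finset.sum_add_distrib, Finset.smul_sum,
    smul_smul]

theorem aeval_pairingPoly_pow {B : V →ₗ[F] V →ₗ[F] F} {N : Module.End F V}
    (hN : ∀ v w : V, B (N v) w + B v (N w) = 0) {m : ℕ} (hm : N ^ m = 0) (j : ℕ) (v w : V) :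
    Polynomial.aeval N (pairingPoly B N m ((N ^ j) v) w) v =
      (-1 : F) ^ j • (N ^ j) (Polynomial.aeval N (pairingPoly B N m v w) v) := by
  have hc : Commute (N ^ j) (conjSum N m ((B v).smulRight v)) :=
    Commute.pow_left (mul_conjSum hm _) j
  rw [← conjSum_smulRight_apply, ← conjSum_smulRight_apply, ← Module.End.mul_apply, hc.eq]
  simp only [conjSum, Module.End.mul_apply, LinearMap.sum_apply, LinearMap.smulRight_apply,
    Finset.smul_sum, map_smul, smul_smul]
  refine Finset.sum_congr rfl fun i _ => ?_
  rw [skew_pow_apply hN, ← Module.End.mul_apply, ← Module.End.mul_apply, ← pow_add, ← pow_add,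
    add_comm]

theorem exists_aeval_mul_pairingPoly_eq_one {B : V →ₗ[F] V →ₗ[F] F} {N : Module.End F V} {m : ℕ}
    (hm : N ^ m = 0) (hm0 : 0 < m) {v w : V} (hvw : B v ((N ^ (m - 1)) w) ≠ 0) :
    ∃ q : Polynomial F,
      Polynomial.aeval N q * Polynomial.aeval N (pairingPoly B N m v w) = 1 := by
  have h0 : (pairingPoly B N m v w).coeff 0 = B v ((N ^ (m - 1)) w) := by
    obtain ⟨k, rfl⟩ : ∃ k, m = k + 1 := ⟨m - 1, by omega⟩
    rw [pairingPoly, Finset.sum_range_succ']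
    simp [Polynomial.coeff_X_pow]
  have hc : IsCoprime (Polynomial.X ^ m) (pairingPoly B N m v w) := by
    refine IsCoprime.pow_left ?_
    rw [Polynomial.irreducible_X.coprime_iff_not_dvd, Polynomial.X_dvd_iff, h0]
    exact hvw
  obtain ⟨a, b, hab⟩ := hc
  refine ⟨b, ?_⟩
  have := congrArg (Polynomial.aeval N) hab
  simpa [hm] using this

theorem aeval_apply_mem {N : Module.End F V} {S : Submodule F V} {x : V}
    (h : ∀ j, (N ^ j) x ∈ S) (q : Polynomial F) : Polynomial.aeval N q x ∈ S := by
  rw [Polynomial.aeval_eq_sum_range, LinearMap.sum_apply]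
  exact S.sum_mem fun i _ => S.smul_mem _ (h i)

theorem finrank_le_finrank_soCent_add [CharZero F] [FiniteDimensional F V]
    {B : V →ₗ[F] V →ₗ[F] F} (hsymm : ∀ v w : V, B v w = B w v)
    {N : Module.End F V} (hN : ∀ v w : V, B (N v) w + B v (N w) = 0) {m : ℕ} (hm : N ^ m = 0)
    (hm0 : 0 < m) {v w : V} (hvw : B v ((N ^ (m - 1)) w) ≠ 0) :
    Module.finrank F V ≤ Module.finrank F (soCent F V B N) + (m + 1) / 2 := by
  set P := Polynomial.aeval N (pairingPoly B N m v w) with hP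
  obtain ⟨q, hq⟩ := exists_aeval_mul_pairingPoly_eq_one hm hm0 hvw
  rw [← hP] at hq
  have hq' : P * Polynomial.aeval N q = 1 := by
    rw [← hq, hP, ← map_mul, ← map_mul, mul_comm]
  set R : Submodule F V := (soCent F V B N).map (LinearMap.applyₗ w) with hR
  set T : Submodule F V :=
    Submodule.span F (Set.range fun t : Fin ((m + 1) / 2) => (N ^ (m - 1 - 2 * (t : ℕ))) (P v))
    with hT
  have hmemR : ∀ u, P u + (-1 : F) ^ m • Polynomial.aeval N (pairingPoly B N m u w) v ∈ R :=
    fun u => ⟨_, conjSum_rankTwo_mem hsymm hN hm u v, conjSum_rankTwo_apply B N m u v w⟩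
  have hpow : ∀ j, (N ^ j) (P v) ∈ R ⊔ T := by
    intro j
    rcases le_or_gt m j with hj | hj
    · rw [pow_eq_zero_of_le hj hm]
      exact Submodule.zero_mem _
    by_cases hpar : Even (m + j)
    · refine Submodule.mem_sup_left ?_
      have h := hmemR ((N ^ j) v)
      have hPN : P ((N ^ j) v) = (N ^ j) (P v) := by
        have hX : N ^ j = Polynomial.aeval N (Polynomial.X ^ j : Polynomial F) := by simp
        rw [← Module.End.mul_apply, ← Module.End.mul_apply, hX, hP, ← map_mul, ← map_mul, mul_comm]
      rw [aeval_pairingPoly_pow hN hm, smul_smul, ← pow_add, hpar.neg_one_pow, one_smul, ← hP,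
        hPN, ← two_smul F] at h
      exact (R.smul_mem_iff two_ne_zero).1 h
    · refine Submodule.mem_sup_right (Submodule.subset_span ⟨⟨(m - 1 - j) / 2, by omega⟩, ?_⟩)
      rw [Nat.not_even_iff_odd] at hpar
      obtain ⟨r, hr⟩ := hpar
      simp only
      congr 2
      omega
  have hv : ∀ j, (N ^ j) v ∈ R ⊔ T := by
    intro j
    have h := aeval_apply_mem hpow (Polynomial.X ^ j * q)
    rwa [map_mul, map_pow, Polynomial.aeval_X, Module.End.mul_apply, ← Module.End.mul_apply _ P,
      hq, Module.End.one_apply] at h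
  have htop : R ⊔ T = ⊤ := by
    rw [eq_top_iff]
    intro x _
    have h := Submodule.sub_mem _ (Submodule.mem_sup_left (hmemR (Polynomial.aeval N q x)))
      (Submodule.smul_mem _ ((-1 : F) ^ m)
        (aeval_apply_mem hv (pairingPoly B N m (Polynomial.aeval N q x) w)))
    rwa [add_sub_cancel_right, ← Module.End.mul_apply, hq', Module.End.one_apply] at h
  have h1 := Submodule.finrank_add_le_finrank_add_finrank R T
  rw [htop, finrank_top] at h1
  have h2 : Module.finrank F R ≤ Module.finrank F (soCent F V B N) :=
    Submodule.finrank_map_le (LinearMap.applyₗ w) (soCent F V B N)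
  have h3 : Module.finrank F T ≤ Fintype.card (Fin ((m + 1) / 2)) := finrank_range_le_card _
  rw [Fintype.card_fin] at h3
  omega

theorem pow_finrank_eq_zero_of_isNilpotent [FiniteDimensional F V] {N : Module.End F V}
    (hN : IsNilpotent N) : N ^ Module.finrank F V = 0 := by
  obtain ⟨k, hk⟩ := hN
  have h := N.aeval_self_charpoly
  rwa [(LinearMap.charpoly_eq_X_pow_iff N).2 fun x => ⟨k, by rw [hk, LinearMap.zero_apply]⟩,
    map_pow, Polynomial.aeval_X] at h

theorem pow_two_mul_ne_zero_of_finrank_soCent [CharZero F] [FiniteDimensional F V] {n : ℕ}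
    (hd : Module.finrank F V = 2 * n + 1) {B : V →ₗ[F] V →ₗ[F] F}
    (hsymm : ∀ v w : V, B v w = B w v) (hnd : ∀ v : V, (∀ w : V, B v w = 0) → v = 0)
    {N : Module.End F V} (hnil : IsNilpotent N) (hN : ∀ v w : V, B (N v) w + B v (N w) = 0)
    (hreg : Module.finrank F (soCent F V B N) = n) : N ^ (2 * n) ≠ 0 := by
  have : Nontrivial V := Module.nontrivial_of_finrank_pos (R := F) (by omega)
  have hne := pow_pred_nilpotencyClass hnil
  obtain ⟨w, hw⟩ : ∃ w, (N ^ (nilpotencyClass N - 1)) w ≠ 0 := by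
    by_contra! h
    exact hne (LinearMap.ext h)
  obtain ⟨v, hv⟩ : ∃ v, B v ((N ^ (nilpotencyClass N - 1)) w) ≠ 0 := by
    by_contra! h
    exact hw (hnd _ fun u => by rw [hsymm, h])
  have hle := finrank_le_finrank_soCent_add hsymm hN (pow_nilpotencyClass hnil)
    (pos_nilpotencyClass_iff.2 hnil) hv
  intro h0
  exact hne (pow_eq_zero_of_le (by omega) h0)

theorem exists_self_pairing_ne_zero [CharZero F] {B : V →ₗ[F] V →ₗ[F] F}
    (hsymm : ∀ v w : V, B v w = B w v) (hnd : ∀ v : V, (∀ w : V, B v w = 0) → v = 0)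
    {N : Module.End F V} (hN : ∀ v w : V, B (N v) w + B v (N w) = 0) {n : ℕ}
    (hne : N ^ (2 * n) ≠ 0) : ∃ v, B v ((N ^ (2 * n)) v) ≠ 0 := by
  by_contra! h
  refine hne (LinearMap.ext fun w => hnd _ fun v => ?_)
  have h1 := h (v + w)
  simp only [map_add, LinearMap.add_apply, h, zero_add, add_zero] at h1
  have h2 := skew_pow_apply hN (2 * n) v w
  rw [(even_two_mul n).neg_one_pow, one_mul, hsymm] at h2
  rw [h2] at h1
  rw [hsymm]
  exact add_self_eq_zero.1 h1

theorem pairing_odd_pow_eq_zero [CharZero F] {B : V →ₗ[F] V →ₗ[F] F}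
    (hsymm : ∀ v w : V, B v w = B w v)
    {N : Module.End F V} (hN : ∀ v w : V, B (N v) w + B v (N w) = 0) {i : ℕ} (hi : Odd i) (v : V) :
    B v ((N ^ i) v) = 0 := by
  have h := skew_pow_apply hN i v v
  rw [hi.neg_one_pow, hsymm, neg_one_mul] at h
  exact self_eq_neg.1 h

/-- A vector pairing nontrivially with `N ^ (2 * n) v` can be corrected by even powers of `N` so
that it pairs trivially with all its lower iterates. -/
theorem exists_pairing_eq_zero_of_lt [CharZero F] {B : V →ₗ[F] V →ₗ[F] F}
    (hsymm : ∀ v w : V, B v w = B w v) {N : Module.End F V}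
    (hN : ∀ v w : V, B (N v) w + B v (N w) = 0) {n : ℕ} (h0 : N ^ (2 * n + 1) = 0)
    (hex : ∃ v, B v ((N ^ (2 * n)) v) ≠ 0) :
    ∃ v, B v ((N ^ (2 * n)) v) ≠ 0 ∧ ∀ i < 2 * n, B v ((N ^ i) v) = 0 := by
  suffices h : ∀ j ≤ n, ∃ v, B v ((N ^ (2 * n)) v) ≠ 0 ∧
      ∀ i < 2 * n, 2 * n ≤ i + 2 * j → B v ((N ^ i) v) = 0 by
    obtain ⟨v, hv, hv'⟩ := h n le_rfl
    exact ⟨v, hv, fun i hi => hv' i hi (by omega)⟩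
  intro j
  induction j with
  | zero =>
    intro _
    obtain ⟨v, hv⟩ := hex
    exact ⟨v, hv, fun i hi hi' => by omega⟩
  | succ j ih =>
    intro hj
    obtain ⟨v, hv, hv'⟩ := ih (by omega)
    set e := 2 * (j + 1) with he
    have hee : Even e := even_two_mul _
    set a : F := -B v ((N ^ (2 * n - e)) v) / (2 * B v ((N ^ (2 * n)) v)) with ha
    have hexp : ∀ i, B (v + a • (N ^ e) v) ((N ^ i) (v + a • (N ^ e) v)) =
        B v ((N ^ i) v) + 2 * a * B v ((N ^ (i + e)) v) +
          a ^ 2 * B v ((N ^ (i + 2 * e)) v) := by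
      intro i
      simp only [map_add, map_smul, LinearMap.add_apply, LinearMap.smul_apply, smul_eq_mul,
        skew_pow_apply hN, hee.neg_one_pow, ← Module.End.mul_apply, ← pow_add]
      rw [show e + (i + e) = i + 2 * e by omega, add_comm e i]
      ring
    have hbig : ∀ i, 2 * n < i → B v ((N ^ i) v) = 0 := fun i hi => by
      rw [pow_eq_zero_of_le hi h0, LinearMap.zero_apply, map_zero]
    refine ⟨v + a • (N ^ e) v, ?_, fun i hi hi' => ?_⟩
    · rw [hexp, hbig (2 * n + e) (by omega), hbig (2 * n + 2 * e) (by omega)]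
      simpa using hv
    · rcases Nat.even_or_odd i with hpar | hpar
      · rw [hexp, hbig (i + 2 * e) (by omega)]
        rcases hi'.eq_or_lt with heq | hlt
        · rw [← heq, ha, show i = 2 * n - e by omega]
          field_simp
          ring
        · obtain ⟨r, hr⟩ := hpar
          rw [hv' i hi (by omega), hbig (i + e) hlt]
          ring
      · exact pairing_odd_pow_eq_zero hsymm hN hpar _

theorem pairing_pow_pow {B : V →ₗ[F] V →ₗ[F] F} {N : Module.End F V}
    (hN : ∀ v w : V, B (N v) w + B v (N w) = 0) {n : ℕ} (h0 : N ^ (2 * n + 1) = 0) {v : V}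
    (hv : ∀ i < 2 * n, B v ((N ^ i) v) = 0) (i j : ℕ) :
    B ((N ^ i) v) ((N ^ j) v) = if i + j = 2 * n then (-1) ^ i * B v ((N ^ (2 * n)) v) else 0 := by
  rw [skew_pow_apply hN, ← Module.End.mul_apply, ← pow_add]
  split_ifs with h
  · rw [h]
  · rcases lt_or_gt_of_ne h with h | h
    · rw [hv _ h, mul_zero]
    · rw [pow_eq_zero_of_le h h0, LinearMap.zero_apply, map_zero, mul_zero]

theorem linearIndependent_pow_apply {B : V →ₗ[F] V →ₗ[F] F} {N : Module.End F V}
    (hN : ∀ v w : V, B (N v) w + B v (N w) = 0) {n : ℕ} (h0 : N ^ (2 * n + 1) = 0) {v : V}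
    (hv0 : B v ((N ^ (2 * n)) v) ≠ 0) (hv : ∀ i < 2 * n, B v ((N ^ i) v) = 0) :
    LinearIndependent F fun i : Fin (2 * n + 1) => (N ^ (i : ℕ)) v := by
  rw [Fintype.linearIndependent_iff]
  intro a ha l
  have h := congrArg (fun x => B x ((N ^ (2 * n - l : ℕ)) v)) ha
  simp only [map_sum, LinearMap.sum_apply, map_smul, LinearMap.smul_apply, map_zero,
    LinearMap.zero_apply, pairing_pow_pow hN h0 hv] at h
  rw [Finset.sum_eq_single l] at h
  · rw [if_pos (by omega)] at h
    simpa [hv0] using h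
  · intro i _ hi
    rw [if_neg, smul_zero]
    have := Fin.val_ne_of_ne hi
    omega
  · simp

/-- A similitude of factor `r` of an odd-dimensional space becomes, after rescaling, an isometry
of determinant one. -/
theorem exists_scalar_isometry_of_similitude [FiniteDimensional F V] {n : ℕ}
    (hd : Module.finrank F V = 2 * n + 1) {B : V →ₗ[F] V →ₗ[F] F}
    (hnd : ∀ v : V, (∀ w : V, B v w = 0) → v = 0) (f : V ≃ₗ[F] V) {r : F}
    (hf : ∀ v w, B (f v) (f w) = r * B v w) :
    ∃ s : Fˣ, (∀ v w, B (s • f v) (s • f w) = B v w) ∧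
      LinearMap.det ((s : F) • (f : V →ₗ[F] V)) = 1 := by
  classical
  set b := Module.finBasis F V
  have hG : (LinearMap.toMatrix₂ b b B).det ≠ 0 :=
    (LinearMap.separatingLeft_iff_det_ne_zero b).1 fun v hv => hnd v hv
  have hdf : LinearMap.det (f : V →ₗ[F] V) ≠ 0 := (LinearEquiv.isUnit_det' f).ne_zero
  set δ := LinearMap.det (f : V →ₗ[F] V) with hδ
  have hr : δ ^ 2 = r ^ (2 * n + 1) := by
    have h : B.compl₁₂ (f : V →ₗ[F] V) (f : V →ₗ[F] V) = r • B := by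
      ext v w
      simp [hf]
    have h2 := congrArg (fun C => (LinearMap.toMatrix₂ b b C).det) h
    simp only [LinearMap.toMatrix₂_compl₁₂ b b, Matrix.det_mul, Matrix.det_transpose,
      LinearMap.det_toMatrix, map_smul, Matrix.det_smul, Fintype.card_fin, hd, ← hδ] at h2
    refine mul_right_cancel₀ hG ?_
    rw [← h2]
    ring
  have hr0 : r ≠ 0 := by
    rintro rfl
    rw [zero_pow (by omega)] at hr
    exact hdf (pow_eq_zero_iff two_ne_zero |>.1 hr)
  have hs : (r ^ n / δ) ^ 2 * r = 1 := by
    rw [div_pow, hr]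
    field_simp
    ring
  refine ⟨Units.mk0 (r ^ n / δ) (div_ne_zero (pow_ne_zero _ hr0) hdf), fun v w => ?_, ?_⟩
  · simp only [Units.smul_mk0, map_smul, LinearMap.smul_apply, smul_eq_mul, hf]
    linear_combination B v w * hs
  · rw [LinearMap.det_smul, hd, ← hδ, Units.val_mk0]
    calc (r ^ n / δ) ^ (2 * n + 1) * δ = ((r ^ n / δ) ^ 2) ^ n * (r ^ n / δ * δ) := by ring
      _ = ((r ^ n / δ) ^ 2 * r) ^ n := by rw [div_mul_cancel₀ _ hdf, mul_pow]
      _ = 1 := by rw [hs, one_pow]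

end RegularNilpotent

/-- Let `B` be a split nondegenerate symmetric bilinear form on a
`(2n+1)`-dimensional space `V` over a field of characteristic zero (split: there is an
`n`-dimensional totally isotropic subspace).  If `N, N'` are regular nilpotent elements
of `so(V, B)` (nilpotent, skew-adjoint, with centralizer in `so(V, B)` of dimension
`n`), then some `g ∈ SO(V, B)(F)` — an isometry of `B` of determinant one — conjugates
`N` to `N'`. -/
theorem stmt_18 (F V : Type*) [Field F] [CharZero F] [AddCommGroup V] [Module F V]
    [FiniteDimensional F V] (n : ℕ) (hd : Module.finrank F V = 2 * n + 1)
    (B : V →ₗ[F] V →ₗ[F] F)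
    (hsymm : ∀ v w : V, B v w = B w v)
    (hnd : ∀ v : V, (∀ w : V, B v w = 0) → v = 0)
    (hsplit : ∃ U : Submodule F V, Module.finrank F ↥U = n ∧
      ∀ u ∈ U, ∀ u' ∈ U, B u u' = 0)
    (N N' : Module.End F V)
    (hN : IsNilpotent N) (hN' : IsNilpotent N')
    (hNso : ∀ v w : V, B (N v) w + B v (N w) = 0)
    (hN'so : ∀ v w : V, B (N' v) w + B v (N' w) = 0)
    (hNreg : Module.finrank F ↥(soCent F V B N) = n)
    (hN'reg : Module.finrank F ↥(soCent F V B N') = n) :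
    ∃ g : V ≃ₗ[F] V, (∀ v w : V, B (g v) (g w) = B v w) ∧
      LinearMap.det (g : V →ₗ[F] V) = 1 ∧
      (g : V →ₗ[F] V) ∘ₗ N ∘ₗ (g.symm : V →ₗ[F] V) = N' := by
  have h1 : N ^ (2 * n + 1) = 0 := hd ▸ pow_finrank_eq_zero_of_isNilpotent hN
  have h1' : N' ^ (2 * n + 1) = 0 := hd ▸ pow_finrank_eq_zero_of_isNilpotent hN'
  obtain ⟨v, hv0, hv⟩ := exists_pairing_eq_zero_of_lt hsymm hNso h1
    (exists_self_pairing_ne_zero hsymm hnd hNso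
      (pow_two_mul_ne_zero_of_finrank_soCent hd hsymm hnd hN hNso hNreg))
  obtain ⟨v', hv0', hv'⟩ := exists_pairing_eq_zero_of_lt hsymm hN'so h1'
    (exists_self_pairing_ne_zero hsymm hnd hN'so
      (pow_two_mul_ne_zero_of_finrank_soCent hd hsymm hnd hN' hN'so hN'reg))
  set b := basisOfLinearIndependentOfCardEqFinrank
    (linearIndependent_pow_apply hNso h1 hv0 hv) (by rw [hd, Fintype.card_fin]) with hb
  set b' := basisOfLinearIndependentOfCardEqFinrank
    (linearIndependent_pow_apply hN'so h1' hv0' hv') (by rw [hd, Fintype.card_fin]) with hb'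
  set f := b.equiv b' (Equiv.refl _) with hf
  have hbi : ∀ i, b i = (N ^ (i : ℕ)) v := fun i => by simp [hb]
  have hfb : ∀ i : Fin (2 * n + 1), f ((N ^ (i : ℕ)) v) = (N' ^ (i : ℕ)) v' := fun i => by
    rw [← hbi, hf, Module.Basis.equiv_apply]
    simp [hb']
  have hfN : ∀ x, f (N x) = N' (f x) := by
    refine fun x => LinearMap.congr_fun (f := (f : V →ₗ[F] V) ∘ₗ N)
      (g := N' ∘ₗ (f : V →ₗ[F] V)) (b.ext fun i => ?_) x
    simp only [LinearMap.comp_apply, LinearEquiv.coe_coe, hbi, hfb]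
    rw [← Module.End.mul_apply, ← pow_succ', ← Module.End.mul_apply, ← pow_succ']
    rcases Nat.lt_or_ge (i + 1) (2 * n + 1) with hi | hi
    · exact hfb ⟨i + 1, hi⟩
    · rw [pow_eq_zero_of_le hi h1, pow_eq_zero_of_le hi h1', LinearMap.zero_apply, map_zero,
        LinearMap.zero_apply]
  have hfB : ∀ x y, B (f x) (f y) =
      B v' ((N' ^ (2 * n)) v') / B v ((N ^ (2 * n)) v) * B x y := by
    have h : B.compl₁₂ (f : V →ₗ[F] V) (f : V →ₗ[F] V) =
        (B v' ((N' ^ (2 * n)) v') / B v ((N ^ (2 * n)) v)) • B := by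
      refine LinearMap.ext_basis b b fun i j => ?_
      simp only [LinearMap.compl₁₂_apply, LinearEquiv.coe_coe, LinearMap.smul_apply, hbi, hfb,
        pairing_pow_pow hNso h1 hv, pairing_pow_pow hN'so h1' hv']
      split_ifs
      · rw [smul_eq_mul]
        field_simp
      · rw [smul_zero]
    intro x y
    simpa using LinearMap.congr_fun₂ h x y
  obtain ⟨s, hs, hdet⟩ := exists_scalar_isometry_of_similitude hd hnd f hfB
  refine ⟨f.trans (LinearEquiv.smulOfUnit s), hs, ?_, ?_⟩
  · convert hdet
    ext x
    rfl
  · refine LinearMap.ext fun y => ?_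
    obtain ⟨x, rfl⟩ := (f.trans (LinearEquiv.smulOfUnit s)).surjective y
    simp only [LinearMap.comp_apply, LinearEquiv.coe_coe, LinearEquiv.symm_apply_apply]
    change s • f (N x) = N' (s • f x)
    rw [hfN, Units.smul_def, Units.smul_def, map_smul]
end
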